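/- arXiv:2309.11005 — 9 statements merged into one kernel-verified Lean document; each statement's English description precedes it below -/
import Mathlib

section
/- Let μ and ν be probability measures on a measurable space Ω that are (ε,δ)-indistinguishable, i.e., μ(S) ≤ e^ε·ν(S) + δ for every measurable set S, and let κ be a Markov kernel from Ω to a measurable space Ω'. Then the measures μ.bind κ and ν.bind κ (obtained by composing with the randomized post-processing κ) are also (ε,δ)-indistinguishable: (μ.bind κ)(S') ≤ e^ε·(ν.bind κ)(S') + δ for every measurable S' ⊆ Ω'. -/
open MeasureTheory ProbabilityTheory Real

/-- If `μ S ≤ ν S + d` for every measurable set `S`, the same bound holds with `S` replaced by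
any measurable function with values in `[0, 1]`. -/
theorem lintegral_le_lintegral_add_of_measure_le_add {α : Type*} [MeasurableSpace α]
    (μ ν : Measure α) [IsFiniteMeasure μ] [IsFiniteMeasure ν] {d : ENNReal}
    (h : ∀ S, MeasurableSet S → μ S ≤ ν S + d)
    {f : α → ENNReal} (hf : Measurable f) (hf1 : ∀ x, f x ≤ 1) :
    ∫⁻ x, f x ∂μ ≤ ∫⁻ x, f x ∂ν + d := by
  obtain ⟨s, hs⟩ := exists_isHahnDecomposition μ ν
  have hsm := hs.measurableSet
  have split (ρ : Measure α) :
      ∫⁻ x in sᶜ, f x ∂ρ + ∫⁻ x in sᶜ, (1 - f x) ∂ρ = ρ sᶜ := by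
    rw [← lintegral_add_left hf]
    simp [add_tsub_cancel_of_le (hf1 _)]
  have h_fin : ∫⁻ x in sᶜ, (1 - f x) ∂ν ≠ ⊤ :=
    ne_top_of_le_ne_top (measure_ne_top ν sᶜ) (le_add_self.trans (split ν).le)
  have h_pos : ∫⁻ x in s, f x ∂μ ≤ ∫⁻ x in s, f x ∂ν :=
    lintegral_mono' hs.le_on le_rfl
  have h_neg : ∫⁻ x in sᶜ, f x ∂μ ≤ ∫⁻ x in sᶜ, f x ∂ν + d := by
    refine (ENNReal.add_le_add_iff_right h_fin).1 ?_
    calc ∫⁻ x in sᶜ, f x ∂μ + ∫⁻ x in sᶜ, (1 - f x) ∂ν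
        ≤ ∫⁻ x in sᶜ, f x ∂μ + ∫⁻ x in sᶜ, (1 - f x) ∂μ :=
          add_le_add le_rfl (lintegral_mono' hs.ge_on_compl le_rfl)
      _ = μ sᶜ := split μ
      _ ≤ ν sᶜ + d := h _ hsm.compl
      _ = ∫⁻ x in sᶜ, f x ∂ν + d + ∫⁻ x in sᶜ, (1 - f x) ∂ν := by
          rw [← split ν, add_right_comm]
  rw [← lintegral_add_compl f hsm, ← lintegral_add_compl f hsm (μ := ν), add_assoc]
  exact add_le_add h_pos h_neg

/-- **Randomised post-processing inequality.** If probability measures `μ` and `ν` are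
`(ε,δ)`-indistinguishable, then so are the measures obtained by composing with a Markov
kernel `κ` (randomised post-processing). -/
theorem postprocessing_bind {Ω Ω' : Type*} [MeasurableSpace Ω] [MeasurableSpace Ω']
    (μ ν : Measure Ω) [IsProbabilityMeasure μ] [IsProbabilityMeasure ν]
    (ε δ : ℝ) (hε : 0 ≤ ε) (hδ : 0 ≤ δ)
    (hind : ∀ S : Set Ω, MeasurableSet S →
      (μ S).toReal ≤ Real.exp ε * (ν S).toReal + δ)
    (κ : ProbabilityTheory.Kernel Ω Ω') [ProbabilityTheory.IsMarkovKernel κ] :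
    ∀ S' : Set Ω', MeasurableSet S' →
      ((μ.bind κ) S').toReal ≤ Real.exp ε * ((ν.bind κ) S').toReal + δ := by
  have hexp : 0 ≤ Real.exp ε := (Real.exp_pos ε).le
  have toReal_iff (a b : ENNReal) (ha : a ≠ ⊤) (hb : b ≠ ⊤) :
      a.toReal ≤ Real.exp ε * b.toReal + δ ↔
        a ≤ ENNReal.ofReal (Real.exp ε) * b + ENNReal.ofReal δ := by
    rw [← ENNReal.toReal_le_toReal ha (by finiteness),
      ENNReal.toReal_add (by finiteness) (by finiteness), ENNReal.toReal_mul,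
      ENNReal.toReal_ofReal hexp, ENNReal.toReal_ofReal hδ]
  intro S' hS'
  rw [toReal_iff _ _ (measure_ne_top _ _) (measure_ne_top _ _),
    Measure.bind_apply hS' κ.measurable.aemeasurable,
    Measure.bind_apply hS' κ.measurable.aemeasurable]
  have : IsFiniteMeasure (ENNReal.ofReal (Real.exp ε) • ν) :=
    Measure.smul_finite ν ENNReal.ofReal_ne_top
  have key := lintegral_le_lintegral_add_of_measure_le_add μ (ENNReal.ofReal (Real.exp ε) • ν)
    (d := ENNReal.ofReal δ)
    (fun S hS => by
      simpa using (toReal_iff _ _ (measure_ne_top μ S) (measure_ne_top ν S)).1 (hind S hS))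
    (κ.measurable_coe hS') (fun _ => prob_le_one)
  rwa [lintegral_smul_measure, smul_eq_mul] at key
end

section
/- Let a, b ∈ ℝ with a ≠ b and σ > 0, and define the privacy loss function ℓ : ℝ → ℝ by ℓ(y) = ((a − b)·y − (a² − b²)/2)/σ², which equals the log-likelihood ratio log(pdf of N(a,σ²) at y / pdf of N(b,σ²) at y). Then the pushforward of the Gaussian measure N(a, σ²) under ℓ is the Gaussian measure N((a−b)²/(2σ²), (a−b)²/σ²); that is, the privacy loss random variable of the Gaussian mechanism is itself Gaussian with mean (a−b)²/(2σ²) and variance (a−b)²/σ². -/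
open MeasureTheory ProbabilityTheory Real

/-- The image of a real Gaussian measure under an affine map, with the mean and variance of the
image given up to equality. -/
lemma gaussianReal_map_const_mul_sub_const {m n c d : ℝ} {v w : NNReal}
    (hn : c * m - d = n) (hw : c ^ 2 * (v : ℝ) = w) :
    (gaussianReal m v).map (fun x => c * x - d) = gaussianReal n w := by
  have hcomp : (fun x : ℝ => c * x - d) = (fun x => x - d) ∘ fun x => c * x := rfl
  rw [hcomp, ← Measure.map_map (by fun_prop) (by fun_prop), gaussianReal_map_const_mul,
    gaussianReal_map_sub_const, hn]
  congr 1
  exact NNReal.eq hw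

/-- **The privacy loss random variable of the Gaussian mechanism is Gaussian.**
For `a ≠ b` and `σ > 0`, the pushforward of `N(a, σ²)` under the privacy loss
function `ℓ(y) = ((a − b)·y − (a² − b²)/2)/σ²` is `N((a−b)²/(2σ²), (a−b)²/σ²)`. -/
theorem privacy_loss_is_gaussian (a b σ : ℝ) (hab : a ≠ b) (hσ : 0 < σ)
    (ℓ : ℝ → ℝ) (hℓ : ∀ y, ℓ y = ((a - b) * y - (a ^ 2 - b ^ 2) / 2) / σ ^ 2) :
    (gaussianReal a ⟨σ ^ 2, sq_nonneg σ⟩).map ℓ =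
      gaussianReal ((a - b) ^ 2 / (2 * σ ^ 2))
        ⟨(a - b) ^ 2 / σ ^ 2, by positivity⟩ := by
  have hℓ_eq : ℓ = fun x => (a - b) / σ ^ 2 * x - (a ^ 2 - b ^ 2) / 2 / σ ^ 2 := by
    funext y
    rw [hℓ]
    ring
  subst hℓ_eq
  apply gaussianReal_map_const_mul_sub_const
  · field_simp
    ring
  · change ((a - b) / σ ^ 2) ^ 2 * σ ^ 2 = (a - b) ^ 2 / σ ^ 2
    field_simp
end

section
/- Let a, b ∈ ℝ with a ≠ b, set L = |a − b|, let σ > 0 and ε ≥ 0, and define the privacy loss function ℓ(y) = ((a − b)·y − (a² − b²)/2)/σ². Then for Y distributed according to the Gaussian measure N(a, σ²): P[ℓ(Y) ≥ ε] = Φ(L/(2σ) − εσ/L) and P[ℓ(Y) ≤ −ε] = Φ(−L/(2σ) − εσ/L), where Φ is the cumulative distribution function of the standard Gaussian N(0,1). -/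
open MeasureTheory ProbabilityTheory Real

/-- The cumulative distribution function `Φ` of the standard Gaussian `N(0,1)`. -/
noncomputable def stdGaussianCDF (x : ℝ) : ℝ :=
  ((gaussianReal 0 1) (Set.Iic x)).toReal

/-- If `z ↦ c * z + a` pulls a measurable set `S` back to the half-line `Iic x`, then `N(a, c²)`
assigns `S` the mass `Φ(x)`. -/
lemma gaussianReal_toReal_eq_stdGaussianCDF {a c x : ℝ} {v : NNReal} {S : Set ℝ}
    (hv : (v : ℝ) = c ^ 2) (hS : MeasurableSet S) (h : ∀ z, c * z + a ∈ S ↔ z ≤ x) :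
    ((gaussianReal a v) S).toReal = stdGaussianCDF x := by
  have hmap : (gaussianReal 0 1).map (fun z ↦ c * z + a) = gaussianReal a v := by
    have hcomp : (fun z : ℝ ↦ c * z + a) = (· + a) ∘ (c * ·) := rfl
    rw [hcomp, ← Measure.map_map (by fun_prop) (by fun_prop), gaussianReal_map_const_mul,
      gaussianReal_map_add_const]
    congr 1
    · simp
    · ext
      simp [hv]
  have hpre : (fun z : ℝ ↦ c * z + a) ⁻¹' S = Set.Iic x := Set.ext h
  rw [← hmap, Measure.map_apply (by fun_prop) hS, hpre, stdGaussianCDF]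

/-- **Tail probabilities of the privacy loss random variable.** With
`ℓ(y) = ((a−b)·y − (a²−b²)/2)/σ²` and `Y ~ N(a, σ²)`, `L = |a − b|`:
`P[ℓ(Y) ≥ ε] = Φ(L/(2σ) − εσ/L)` and `P[ℓ(Y) ≤ −ε] = Φ(−L/(2σ) − εσ/L)`. -/
theorem privacy_loss_tail_probabilities (a b σ ε L : ℝ) (hab : a ≠ b) (hσ : 0 < σ)
    (hε : 0 ≤ ε) (hL : L = |a - b|)
    (ℓ : ℝ → ℝ) (hℓ : ∀ y, ℓ y = ((a - b) * y - (a ^ 2 - b ^ 2) / 2) / σ ^ 2) :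
    ((gaussianReal a ⟨σ ^ 2, sq_nonneg σ⟩) {y | ε ≤ ℓ y}).toReal =
        stdGaussianCDF (L / (2 * σ) - ε * σ / L) ∧
      ((gaussianReal a ⟨σ ^ 2, sq_nonneg σ⟩) {y | ℓ y ≤ -ε}).toReal =
        stdGaussianCDF (-(L / (2 * σ)) - ε * σ / L) := by
  have hd : a - b ≠ 0 := sub_ne_zero.mpr hab
  have hLpos : 0 < L := hL ▸ abs_pos.mpr hd
  have hmeas : Measurable ℓ := by
    rw [funext hℓ]
    fun_prop
  obtain ⟨s, hs, hsd⟩ : ∃ s : ℝ, s ^ 2 = 1 ∧ a - b = s * L := by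
    rcases abs_choice (a - b) with h | h
    · exact ⟨1, by norm_num, by rw [hL, h, one_mul]⟩
    · exact ⟨-1, by norm_num, by rw [hL, h]; ring⟩
  have hb : b = a - s * L := by linarith
  have hℓ_affine (t z : ℝ) : ℓ (t * s * σ * z + a) = L / σ * (t * z + L / (2 * σ)) := by
    rw [hℓ, hb]
    field_simp
    linear_combination L * (2 * t * σ * z + L) * hs
  have hε_eq : ε = L / σ * (ε * σ / L) := by field_simp
  have hpos : 0 < L / σ := div_pos hLpos hσ
  constructor
  · refine gaussianReal_toReal_eq_stdGaussianCDF (c := -1 * s * σ) ?_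
      (measurableSet_le measurable_const hmeas) fun z ↦ ?_
    · change σ ^ 2 = _
      linear_combination -σ ^ 2 * hs
    · rw [Set.mem_ofPred_eq, hℓ_affine, hε_eq, mul_le_mul_iff_right₀ hpos, ← hε_eq]
      constructor <;> intro h <;> linarith
  · refine gaussianReal_toReal_eq_stdGaussianCDF (c := 1 * s * σ) ?_
      (measurableSet_le hmeas measurable_const) fun z ↦ ?_
    · change σ ^ 2 = _
      linear_combination -σ ^ 2 * hs
    · rw [Set.mem_ofPred_eq, hℓ_affine, hε_eq, ← mul_neg, mul_le_mul_iff_right₀ hpos, ← hε_eq]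
      constructor <;> intro h <;> linarith
end

section
/- Let μ and ν be probability measures on a measurable space Ω with μ absolutely continuous with respect to ν, let f denote the Radon–Nikodym derivative dμ/dν, and let ε ≥ 0 and δ ≥ 0. If μ({x : f(x) ≥ e^ε}) − e^ε·ν({x : f(x) ≥ e^ε}) ≤ δ, then μ and ν are (ε,δ)-indistinguishable: μ(S) ≤ e^ε·ν(S) + δ for every measurable set S. -/
open MeasureTheory Real

/-- If `dμ/dν ≤ c` on `s`, then `μ s ≤ c * ν s`. -/
theorem measure_le_mul_of_rnDeriv_le {Ω : Type*} [MeasurableSpace Ω]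
    {μ ν : Measure Ω} [SigmaFinite μ] [SigmaFinite ν] (hac : μ ≪ ν) {c : ENNReal} {s : Set Ω}
    (hs : MeasurableSet s) (hle : ∀ x ∈ s, μ.rnDeriv ν x ≤ c) : μ s ≤ c * ν s := by
  rw [← Measure.setLIntegral_rnDeriv hac s, ← setLIntegral_const]
  exact setLIntegral_mono' hs hle

/-- If `c ≤ dμ/dν` on `s`, then `c * ν s ≤ μ s`. -/
theorem mul_measure_le_of_le_rnDeriv {Ω : Type*} [MeasurableSpace Ω]
    {μ ν : Measure Ω} {c : ENNReal} {s : Set Ω}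
    (hs : MeasurableSet s) (hle : ∀ x ∈ s, c ≤ μ.rnDeriv ν x) : c * ν s ≤ μ s := by
  rw [← setLIntegral_const]
  exact (setLIntegral_mono' hs hle).trans (Measure.setLIntegral_rnDeriv_le s)

/-- **Sufficiency of the privacy-loss criterion.** Let `f = dμ/dν` be the Radon–Nikodym
derivative of `μ` with respect to `ν`, with `μ ≪ ν`. If the super-level set
`T = {x : f x ≥ e^ε}` satisfies `μ(T) − e^ε·ν(T) ≤ δ`, then `μ` and `ν` are
`(ε,δ)`-indistinguishable. -/
theorem indistinguishable_of_level_set {Ω : Type*} [MeasurableSpace Ω]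
    (μ ν : Measure Ω) [IsProbabilityMeasure μ] [IsProbabilityMeasure ν]
    (hac : μ ≪ ν) (ε δ : ℝ) (hε : 0 ≤ ε) (hδ : 0 ≤ δ)
    (h : (μ {x | ENNReal.ofReal (Real.exp ε) ≤ μ.rnDeriv ν x}).toReal -
          Real.exp ε * (ν {x | ENNReal.ofReal (Real.exp ε) ≤ μ.rnDeriv ν x}).toReal ≤ δ) :
    ∀ S : Set Ω, MeasurableSet S →
      (μ S).toReal ≤ Real.exp ε * (ν S).toReal + δ := by
  intro S hS
  set T : Set Ω := {x | ENNReal.ofReal (Real.exp ε) ≤ μ.rnDeriv ν x}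
  have hT : MeasurableSet T := measurableSet_le measurable_const (μ.measurable_rnDeriv ν)
  have hdiff : μ.real (S \ T) ≤ Real.exp ε * ν.real (S \ T) := by
    have := ENNReal.toReal_mono (by finiteness) <|
      measure_le_mul_of_rnDeriv_le hac (hS.diff hT) fun x hx => (not_le.mp hx.2).le
    rwa [ENNReal.toReal_mul, ENNReal.toReal_ofReal (Real.exp_pos ε).le] at this
  have hdiff' : Real.exp ε * ν.real (T \ S) ≤ μ.real (T \ S) := by
    have := ENNReal.toReal_mono (by finiteness) <|
      mul_measure_le_of_le_rnDeriv (hT.diff hS) fun x hx => hx.1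
    rwa [ENNReal.toReal_mul, ENNReal.toReal_ofReal (Real.exp_pos ε).le] at this
  simp only [← measureReal_def] at h ⊢
  rw [← measureReal_inter_add_sdiff (μ := μ) (s := T) hS,
    ← measureReal_inter_add_sdiff (μ := ν) (s := T) hS,
    Set.inter_comm T S] at h
  rw [← measureReal_inter_add_sdiff (μ := μ) (s := S) hT,
    ← measureReal_inter_add_sdiff (μ := ν) (s := S) hT]
  linarith
end

section
/- Let a, b ∈ ℝ with a ≠ b, set L = |a − b|, let σ > 0, ε ≥ 0 and δ ≥ 0. If Φ(L/(2σ) − εσ/L) − e^ε·Φ(−L/(2σ) − εσ/L) ≤ δ, then the Gaussian measures N(a, σ²) and N(b, σ²) are (ε,δ)-indistinguishable: N(a,σ²)(S) ≤ e^ε·N(b,σ²)(S) + δ for every measurable set S ⊆ ℝ. -/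
open MeasureTheory ProbabilityTheory Real

lemma toReal_gaussianReal_apply (m : ℝ) {v : NNReal} (hv : v ≠ 0) (T : Set ℝ) :
    (gaussianReal m v T).toReal = ∫ x in T, gaussianPDFReal m v x := by
  rw [gaussianReal_apply_eq_integral m hv, ENNReal.toReal_ofReal]
  exact integral_nonneg fun x => gaussianPDFReal_nonneg m v x

/-- A Gaussian measure is the image of a unit-variance one under an affine map. -/
lemma gaussianReal_affine_apply (m a s : ℝ) {v : NNReal} (hv : (v : ℝ) = s ^ 2) {S : Set ℝ}
    (hS : MeasurableSet S) :
    gaussianReal (a + s * m) v S = gaussianReal m 1 ((fun y => a + s * y) ⁻¹' S) := by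
  have hmap : (gaussianReal m 1).map (fun y => a + s * y) = gaussianReal (a + s * m) v := by
    have hcomp : (fun y => a + s * y) = (fun y => a + y) ∘ (fun y => s * y) := rfl
    rw [hcomp, ← Measure.map_map (by fun_prop) (by fun_prop), gaussianReal_map_const_mul,
      gaussianReal_map_const_add, add_comm]
    congr 1
    ext
    simp [hv]
  rw [← hmap, Measure.map_apply (by fun_prop) hS]

lemma toReal_gaussianReal_Iic (m c : ℝ) :
    (gaussianReal m 1 (Set.Iic c)).toReal = stdGaussianCDF (c - m) := by
  have h := gaussianReal_affine_apply (v := 1) 0 m 1 (by simp) (measurableSet_Iic (a := c))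
  have hpre : (fun y => m + 1 * y) ⁻¹' Set.Iic c = Set.Iic (c - m) := by
    ext y
    simp [le_sub_iff_add_le, add_comm]
  rw [hpre] at h
  simpa [stdGaussianCDF] using congrArg ENNReal.toReal h

lemma exp_mul_gaussianPDFReal_le_iff {m : ℝ} (hm : 0 < m) (ε x : ℝ) :
    exp ε * gaussianPDFReal m 1 x ≤ gaussianPDFReal 0 1 x ↔ x ≤ m / 2 - ε / m := by
  have hpos : 0 < (√(2 * π))⁻¹ := by positivity
  simp only [gaussianPDFReal, NNReal.coe_one, mul_one]
  rw [mul_left_comm, mul_le_mul_iff_right₀ hpos, ← exp_add, exp_le_exp]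
  have hε : ε / m * m = ε := div_mul_cancel₀ ε hm.ne'
  rw [← mul_le_mul_iff_left₀ hm (b := x), sub_mul, hε]
  constructor <;> intro h <;> nlinarith

/-- Neyman–Pearson: a half-line maximises the hockey-stick gap between two unit Gaussians. -/
lemma gaussianReal_sub_le_stdGaussianCDF_sub {m : ℝ} (hm : 0 < m) (ε : ℝ) {T : Set ℝ}
    (hT : MeasurableSet T) :
    (gaussianReal 0 1 T).toReal - exp ε * (gaussianReal m 1 T).toReal ≤
      stdGaussianCDF (m / 2 - ε / m) - exp ε * stdGaussianCDF (-(m / 2) - ε / m) := by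
  set g : ℝ → ℝ := fun x => gaussianPDFReal 0 1 x - exp ε * gaussianPDFReal m 1 x with hg
  have hint0 := integrable_gaussianPDFReal 0 1
  have hintm := (integrable_gaussianPDFReal m 1).const_mul (exp ε)
  have hgap (U : Set ℝ) : (gaussianReal 0 1 U).toReal - exp ε * (gaussianReal m 1 U).toReal =
      ∫ x in U, g x := by
    rw [toReal_gaussianReal_apply _ one_ne_zero, toReal_gaussianReal_apply _ one_ne_zero,
      hg, integral_sub hint0.integrableOn hintm.integrableOn, integral_const_mul]
  have hset : {x | 0 ≤ g x} = Set.Iic (m / 2 - ε / m) := by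
    ext x
    simp [hg, exp_mul_gaussianPDFReal_le_iff hm]
  have hmeas : StronglyMeasurable g :=
    (stronglyMeasurable_gaussianPDFReal 0 1).sub
      ((stronglyMeasurable_gaussianPDFReal m 1).const_mul (exp ε))
  calc _ = ∫ x in T, g x := hgap T
    _ ≤ ∫ x in {x | 0 ≤ g x}, g x := setIntegral_le_nonneg hT hmeas (hint0.sub hintm)
    _ = _ := by
      rw [hset, ← hgap, toReal_gaussianReal_Iic, toReal_gaussianReal_Iic]
      ring_nf

/-- **Tight analysis of the Gaussian mechanism.** With `L = |a − b|`, if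
`Φ(L/(2σ) − εσ/L) − e^ε·Φ(−L/(2σ) − εσ/L) ≤ δ` then `N(a, σ²)` and `N(b, σ²)` are
`(ε,δ)`-indistinguishable. -/
theorem gaussian_mechanism_tight (a b σ ε δ L : ℝ) (hab : a ≠ b) (hσ : 0 < σ)
    (hε : 0 ≤ ε) (hδ : 0 ≤ δ) (hL : L = |a - b|)
    (h : stdGaussianCDF (L / (2 * σ) - ε * σ / L) -
          Real.exp ε * stdGaussianCDF (-(L / (2 * σ)) - ε * σ / L) ≤ δ) :
    ∀ S : Set ℝ, MeasurableSet S →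
      ((gaussianReal a ⟨σ ^ 2, sq_nonneg σ⟩) S).toReal ≤
        Real.exp ε * ((gaussianReal b ⟨σ ^ 2, sq_nonneg σ⟩) S).toReal + δ := by
  intro S hS
  have hLpos : 0 < L := hL ▸ abs_pos.mpr (sub_ne_zero.mpr hab)
  obtain ⟨s, hs, hb⟩ : ∃ s : ℝ, σ ^ 2 = s ^ 2 ∧ a + s * (L / σ) = b := by
    rcases abs_choice (a - b) with h' | h' <;> rw [h'] at hL
    · exact ⟨-σ, by ring, by rw [hL]; field_simp; ring⟩
    · exact ⟨σ, rfl, by rw [hL]; field_simp; ring⟩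
  have ha := gaussianReal_affine_apply (v := ⟨σ ^ 2, sq_nonneg σ⟩) 0 a s hs hS
  have hb' := gaussianReal_affine_apply (v := ⟨σ ^ 2, sq_nonneg σ⟩) (L / σ) a s hs hS
  rw [mul_zero, add_zero] at ha
  rw [hb] at hb'
  have hT : MeasurableSet ((fun y => a + s * y) ⁻¹' S) :=
    (show Measurable fun y : ℝ => a + s * y by fun_prop) hS
  have key := gaussianReal_sub_le_stdGaussianCDF_sub (div_pos hLpos hσ) ε hT
  have h₁ : L / σ / 2 = L / (2 * σ) := by rw [div_div, mul_comm]
  have h₂ : ε / (L / σ) = ε * σ / L := div_div_eq_mul_div ε L σ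
  rw [← ha, ← hb', h₁, h₂] at key
  linarith
end

section
/- Let a, b ∈ ℝ, let L > 0 with |a − b| ≤ L, let ε ∈ (0,1] and δ ∈ (0,1), and suppose σ ≥ (L/ε)·√(2·ln(1.25/δ)). Then the Gaussian measures N(a, σ²) and N(b, σ²) are (ε,δ)-indistinguishable: N(a,σ²)(S) ≤ e^ε·N(b,σ²)(S) + δ for every measurable set S ⊆ ℝ. -/
open MeasureTheory ProbabilityTheory Real

lemma gaussianReal_real_le_mul_of_pdf_le {m m' C : ℝ} {v v' : NNReal} (hv : v ≠ 0) (hv' : v' ≠ 0)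
    {S : Set ℝ} (hS : MeasurableSet S)
    (h : ∀ x ∈ S, gaussianPDFReal m v x ≤ C * gaussianPDFReal m' v' x) :
    (gaussianReal m v).real S ≤ C * (gaussianReal m' v').real S := by
  have hreal : ∀ (m : ℝ) {v : NNReal}, v ≠ 0 →
      (gaussianReal m v).real S = ∫ x in S, gaussianPDFReal m v x := fun m v hv ↦ by
    rw [measureReal_def, gaussianReal_apply_eq_integral m hv, ENNReal.toReal_ofReal]
    exact integral_nonneg fun x ↦ gaussianPDFReal_nonneg m v x
  rw [hreal m hv, hreal m' hv', ← integral_const_mul]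
  exact setIntegral_mono_on (integrable_gaussianPDFReal m v).integrableOn
    ((integrable_gaussianPDFReal m' v').const_mul C).integrableOn hS h

lemma gaussianReal_zero_one_real_Ioi_zero_le : (gaussianReal 0 1).real (Set.Ioi 0) ≤ 1 / 2 := by
  have hneg : (gaussianReal 0 1).real (Set.Iio 0) = (gaussianReal 0 1).real (Set.Ioi 0) := by
    have hmap : (gaussianReal 0 1).map (fun x ↦ -x) = gaussianReal 0 1 := by
      simpa using gaussianReal_map_neg (μ := 0) (v := 1)
    conv_lhs => rw [← hmap]
    rw [map_measureReal_apply (by fun_prop) measurableSet_Iio]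
    congr 1
    ext x
    simp
  have hunion : (gaussianReal 0 1).real (Set.Iio 0 ∪ Set.Ioi 0) =
      (gaussianReal 0 1).real (Set.Iio 0) + (gaussianReal 0 1).real (Set.Ioi 0) :=
    measureReal_union (Set.disjoint_left.2 fun x (hx : x < 0) (hx' : 0 < x) ↦ hx.not_gt hx')
      measurableSet_Ioi
  have hle : (gaussianReal 0 1).real (Set.Iio 0 ∪ Set.Ioi 0) ≤ 1 := measureReal_le_one
  linarith

lemma gaussianReal_zero_one_real_Ioi_le_exp {r : ℝ} (hr : 0 ≤ r) :
    (gaussianReal 0 1).real (Set.Ioi r) ≤ exp (-r ^ 2 / 2) / 2 := by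
  have hshift : (gaussianReal 0 1).real (Set.Ioi r) =
      (gaussianReal (-r) 1).real (Set.Ioi 0) := by
    have hmap : (gaussianReal 0 1).map (fun x ↦ x - r) = gaussianReal (-r) 1 := by
      simpa using gaussianReal_map_sub_const (μ := 0) (v := 1) r
    rw [← hmap, map_measureReal_apply (by fun_prop) measurableSet_Ioi]
    congr 1
    ext x
    simp
  have hcomp : (gaussianReal (-r) 1).real (Set.Ioi 0) ≤
      exp (-r ^ 2 / 2) * (gaussianReal 0 1).real (Set.Ioi 0) := by
    refine gaussianReal_real_le_mul_of_pdf_le one_ne_zero one_ne_zero measurableSet_Ioi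
      fun x (hx : 0 < x) ↦ ?_
    rw [gaussianPDFReal, gaussianPDFReal, mul_left_comm, ← exp_add]
    gcongr
    simp only [NNReal.coe_one]
    nlinarith [mul_nonneg hr hx.le]
  rw [hshift]
  nlinarith [gaussianReal_zero_one_real_Ioi_zero_le, exp_pos (-r ^ 2 / 2)]

lemma gaussianReal_zero_one_real_Ioi_le_sub {r : ℝ} (hr : r ≤ 0) :
    (gaussianReal 0 1).real (Set.Ioi r) ≤ 1 / 2 - r := by
  have hpdf : ∀ x, gaussianPDFReal 0 1 x ≤ 1 := fun x ↦ by
    rw [gaussianPDFReal]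
    refine mul_le_one₀ (inv_le_one_of_one_le₀ ?_) (exp_pos _).le (exp_le_one_iff.2 ?_)
    · rw [Real.one_le_sqrt]
      simp only [NNReal.coe_one]
      linarith [pi_gt_three]
    · simp only [NNReal.coe_one]
      nlinarith [sq_nonneg (x - 0)]
  have hIoc : (gaussianReal 0 1).real (Set.Ioc r 0) ≤ -r := by
    rw [measureReal_def, gaussianReal_apply_eq_integral 0 one_ne_zero,
      ENNReal.toReal_ofReal (integral_nonneg fun x ↦ gaussianPDFReal_nonneg 0 1 x)]
    refine (setIntegral_mono_on (integrable_gaussianPDFReal 0 1).integrableOn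
      (integrableOn_const measure_Ioc_lt_top.ne) measurableSet_Ioc fun x _ ↦ hpdf x).trans ?_
    simp [hr]
  rw [← Set.Ioc_union_Ioi_eq_Ioi hr]
  linarith [measureReal_union_le (μ := gaussianReal 0 1) (Set.Ioc r 0) (Set.Ioi 0),
    gaussianReal_zero_one_real_Ioi_zero_le]

lemma gaussianReal_zero_one_real_Ioi_sub_inv_le {c : ℝ} (hc : 0 < c) (hc2 : 0.4 ≤ c ^ 2) :
    (gaussianReal 0 1).real (Set.Ioi (c - 1 / (2 * c))) ≤ 1.25 * exp (-c ^ 2 / 2) := by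
  obtain ⟨i, hi⟩ : ∃ i, i = 1 / (2 * c) := ⟨_, rfl⟩
  have hic : i * c = 1 / 2 := by rw [hi]; field_simp
  rw [← hi]
  rcases le_total 0 (c - i) with hr | hr
  · have hhalf : exp (1 / 2) ≤ 2.5 := by
      have hsq : exp (1 / 2) ^ 2 = exp 1 := by rw [← exp_nat_mul]; norm_num
      nlinarith [exp_one_lt_d9, exp_pos (1 / 2 : ℝ)]
    calc (gaussianReal 0 1).real (Set.Ioi (c - i))
        ≤ exp (-(c - i) ^ 2 / 2) / 2 := gaussianReal_zero_one_real_Ioi_le_exp hr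
      _ ≤ exp (1 / 2 + -c ^ 2 / 2) / 2 := by
          gcongr
          nlinarith [sq_nonneg i]
      _ ≤ 1.25 * exp (-c ^ 2 / 2) := by
          rw [exp_add]
          nlinarith [exp_pos (-c ^ 2 / 2)]
  · have hc6 : 0.6 ≤ c := by nlinarith
    have hc_sq : c ^ 2 ≤ 1 / 2 := by nlinarith
    have hi_le : i ≤ 5 / 6 := by nlinarith
    linarith [gaussianReal_zero_one_real_Ioi_le_sub hr, add_one_le_exp (-c ^ 2 / 2)]

lemma gaussianReal_real_preimage_Ioi {a σ s : ℝ} {v : NNReal} (hv : (v : ℝ) = σ ^ 2) (hσ : σ ≠ 0) (hs : s ^ 2 = 1) (r : ℝ) :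
    (gaussianReal a v).real {x | r < s / σ * (x - a)} =
      (gaussianReal 0 1).real (Set.Ioi r) := by
  have hmap : (gaussianReal a v).map (fun x ↦ s / σ * (x - a)) =
      gaussianReal 0 1 := by
    have hcomp : (fun x ↦ s / σ * (x - a)) = (fun x ↦ s / σ * x) ∘ fun x ↦ x - a := rfl
    rw [hcomp, ← Measure.map_map (by fun_prop) (by fun_prop), gaussianReal_map_sub_const,
      gaussianReal_map_const_mul]
    congr 1
    · simp
    · ext
      simp only [NNReal.coe_mul, NNReal.coe_mk, NNReal.coe_one, div_pow, hs, hv]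
      field_simp
  rw [← hmap, map_measureReal_apply (by fun_prop) measurableSet_Ioi]
  rfl

lemma gaussianPDFReal_le_exp_mul {a b ε x : ℝ} {v : NNReal} (hv : v ≠ 0)
    (h : (a - b) * (x - a) ≤ v * ε - (a - b) ^ 2 / 2) :
    gaussianPDFReal a v x ≤ exp ε * gaussianPDFReal b v x := by
  have hv0 : (0 : ℝ) < v := by exact_mod_cast pos_iff_ne_zero.2 hv
  rw [gaussianPDFReal, gaussianPDFReal, mul_left_comm, ← exp_add]
  gcongr
  rw [← sub_nonneg]
  have hdiff : ε + -(x - b) ^ 2 / (2 * v) - -(x - a) ^ 2 / (2 * v) =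
      (v * ε - (a - b) ^ 2 / 2 - (a - b) * (x - a)) / v := by
    field_simp
    ring
  rw [hdiff]
  exact div_nonneg (by linarith) hv0.le

lemma gaussianReal_real_le_exp_mul_add {a b σ c ε L : ℝ} {v : NNReal} (hv : (v : ℝ) = σ ^ 2) (hL : 0 < L) (hab : |a - b| ≤ L)
    (hne : a ≠ b) (hε0 : 0 < ε) (hε1 : ε ≤ 1) (hc : 0 < c) (hσ : L / ε * c ≤ σ)
    {S : Set ℝ} (hS : MeasurableSet S) :
    (gaussianReal a v).real S ≤
      exp ε * (gaussianReal b v).real S +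
        (gaussianReal 0 1).real (Set.Ioi (c - 1 / (2 * c))) := by
  have hσ0 : 0 < σ := lt_of_lt_of_le (by positivity) hσ
  have hv0 : v ≠ 0 := by
    rintro rfl
    exact (pow_pos hσ0 2).ne hv
  have hd : 0 < |a - b| := abs_pos.2 (sub_ne_zero.2 hne)
  obtain ⟨s, hs, hsd⟩ : ∃ s : ℝ, s ^ 2 = 1 ∧ a - b = s * |a - b| := by
    rcases abs_choice (a - b) with h | h
    · exact ⟨1, by norm_num, by rw [h]; ring⟩
    · exact ⟨-1, by norm_num, by rw [h]; ring⟩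
  set d := |a - b|
  set B := {x | c - 1 / (2 * c) < s / σ * (x - a)}
  have hB : MeasurableSet B := measurableSet_lt measurable_const (by fun_prop)
  have hdc : d * c ≤ σ * ε := by
    rw [div_mul_eq_mul_div, div_le_iff₀ hε0] at hσ
    nlinarith
  have hsdiff : (gaussianReal a v).real (S \ B) ≤
      exp ε * (gaussianReal b v).real (S \ B) := by
    refine gaussianReal_real_le_mul_of_pdf_le hv0 hv0 (hS.diff hB) fun x hx ↦
      gaussianPDFReal_le_exp_mul hv0 ?_
    have hx' : s / σ * (x - a) ≤ c - 1 / (2 * c) := not_lt.1 hx.2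
    have hlhs : (a - b) * (x - a) = d * σ * (s / σ * (x - a)) := by
      rw [hsd]; field_simp
    have hsq : (a - b) ^ 2 = d ^ 2 := (sq_abs _).symm
    have hdσ : d * c ≤ σ := hdc.trans (mul_le_of_le_one_right hσ0.le hε1)
    have hinv : d ^ 2 ≤ d * σ * (1 / c) := by
      rw [mul_one_div, le_div_iff₀ hc]
      nlinarith
    have hhalf : 1 / (2 * c) = 1 / c / 2 := by field_simp
    rw [hlhs, hsq, hv]
    calc d * σ * (s / σ * (x - a)) ≤ d * σ * (c - 1 / (2 * c)) := by gcongr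
      _ ≤ σ ^ 2 * ε - d ^ 2 / 2 := by
          rw [hhalf]
          nlinarith
  calc (gaussianReal a v).real S
      ≤ (gaussianReal a v).real (S \ B ∪ B) :=
        measureReal_mono (by rw [Set.sdiff_union_self]; exact Set.subset_union_left)
    _ ≤ (gaussianReal a v).real (S \ B) +
          (gaussianReal a v).real B := measureReal_union_le _ _
    _ ≤ exp ε * (gaussianReal b v).real S +
        (gaussianReal 0 1).real (Set.Ioi (c - 1 / (2 * c))) := by
        refine add_le_add (hsdiff.trans ?_) (gaussianReal_real_preimage_Ioi hv hσ0.ne' hs _).le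
        exact mul_le_mul_of_nonneg_left (measureReal_mono Set.sdiff_subset) (exp_pos ε).le

/-- **Classical Gaussian mechanism guarantee.** If `|a − b| ≤ L`, `ε ∈ (0,1]`,
`δ ∈ (0,1)` and `σ ≥ (L/ε)·√(2·ln(1.25/δ))`, then `N(a, σ²)` and `N(b, σ²)` are
`(ε,δ)`-indistinguishable. -/
theorem gaussian_mechanism_classical (a b σ ε δ L : ℝ) (hL : 0 < L)
    (hab : |a - b| ≤ L) (hε0 : 0 < ε) (hε1 : ε ≤ 1) (hδ0 : 0 < δ) (hδ1 : δ < 1)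
    (hσ : (L / ε) * Real.sqrt (2 * Real.log (1.25 / δ)) ≤ σ) :
    ∀ S : Set ℝ, MeasurableSet S →
      ((gaussianReal a ⟨σ ^ 2, sq_nonneg σ⟩) S).toReal ≤
        Real.exp ε * ((gaussianReal b ⟨σ ^ 2, sq_nonneg σ⟩) S).toReal + δ := by
  intro S hS
  simp only [← measureReal_def]
  have hlog : 1 / 5 ≤ log (1.25 / δ) := by
    have h := one_sub_inv_le_log_of_pos (show 0 < 1.25 / δ by positivity)
    have hδ : δ / 1.25 ≤ 4 / 5 := by rw [div_le_iff₀ (by norm_num)]; linarith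
    rw [inv_div] at h
    linarith
  set c := √(2 * log (1.25 / δ))
  have hc : 0 < c := Real.sqrt_pos.2 (by linarith)
  have hc_sq : c ^ 2 = 2 * log (1.25 / δ) := Real.sq_sqrt (by linarith)
  have htail : 1.25 * exp (-c ^ 2 / 2) = δ := by
    rw [hc_sq, show -(2 * log (1.25 / δ)) / 2 = -log (1.25 / δ) by ring, exp_neg,
      exp_log (by positivity)]
    field_simp
  rcases eq_or_ne a b with rfl | hne
  · nlinarith [one_le_exp hε0.le,
      measureReal_nonneg (μ := gaussianReal a ⟨σ ^ 2, sq_nonneg σ⟩) (s := S)]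
  · linarith [gaussianReal_real_le_exp_mul_add (v := ⟨σ ^ 2, sq_nonneg σ⟩) rfl hL hab hne hε0
      hε1 hc hσ hS,
      gaussianReal_zero_one_real_Ioi_sub_inv_le hc (by linarith)]
end

section
/- Let μ and ν be probability measures on a measurable space Ω, let ε ≥ 0 and δ ≥ 0, and suppose both μ(S) ≤ e^ε·ν(S) + δ and ν(S) ≤ e^ε·μ(S) + δ hold for every measurable set S. Let f_i, f_j : Ω → ℝ be measurable with 0 ≤ f_i ≤ 1 and 0 ≤ f_j ≤ 1. If ∫ f_i dμ − e^{2ε}·(∫ f_j dμ) − (1 + e^ε)·δ ≥ 0, then ∫ f_i dν ≥ ∫ f_j dν. -/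
open MeasureTheory Real

/-- A setwise bound `μ S ≤ c * ν S + δ` between finite measures extends to integrals of
`[0,1]`-valued functions. -/
lemma integral_le_mul_integral_add_of_measure_le {Ω : Type*} [MeasurableSpace Ω]
    {μ ν : Measure Ω} [IsFiniteMeasure μ] [IsFiniteMeasure ν] {c δ : ℝ}
    (h : ∀ S : Set Ω, MeasurableSet S → (μ S).toReal ≤ c * (ν S).toReal + δ)
    {f : Ω → ℝ} (hf : Measurable f) (hf0 : ∀ x, 0 ≤ f x) (hf1 : ∀ x, f x ≤ 1) :
    ∫ x, f x ∂μ ≤ c * (∫ x, f x ∂ν) + δ := by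
  have integrable (ρ : Measure Ω) [IsFiniteMeasure ρ] : Integrable f ρ :=
    Integrable.of_bound hf.aestronglyMeasurable 1
      (.of_forall fun x ↦ by simpa [abs_of_nonneg (hf0 x)] using hf1 x)
  have layercake (ρ : Measure Ω) [IsFiniteMeasure ρ] :
      ∫ x, f x ∂ρ = ∫ t in Set.Ioc (0 : ℝ) 1, ρ.real {x | t ≤ f x} :=
    (integrable ρ).integral_eq_integral_Ioc_meas_le (.of_forall hf0) (.of_forall hf1)
  have tail_integrable (ρ : Measure Ω) [IsFiniteMeasure ρ] :
      IntegrableOn (fun t : ℝ ↦ ρ.real {x | t ≤ f x}) (Set.Ioc 0 1) := by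
    have tail_antitone : Antitone fun t : ℝ ↦ ρ.real {x | t ≤ f x} :=
      fun s t hst ↦ measureReal_mono fun x (hx : t ≤ f x) ↦ hst.trans hx
    exact ((tail_antitone.antitoneOn _).integrableOn_isCompact isCompact_Icc).mono_set
      Set.Ioc_subset_Icc_self
  calc
    ∫ x, f x ∂μ = ∫ t in Set.Ioc (0 : ℝ) 1, μ.real {x | t ≤ f x} := layercake μ
    _ ≤ ∫ t in Set.Ioc (0 : ℝ) 1, (c * ν.real {x | t ≤ f x} + δ) :=
      setIntegral_mono (tail_integrable μ)
        (((tail_integrable ν).const_mul c).add (integrable_const δ))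
        fun t ↦ h _ (measurableSet_le measurable_const hf)
    _ = c * (∫ x, f x ∂ν) + δ := by
      rw [integral_add ((tail_integrable ν).const_mul c) (integrable_const δ),
        integral_const_mul, ← layercake ν]
      simp

/-- **Robustness condition (Equation (13)).** If `μ` and `ν` are `(ε,δ)`-indistinguishable
in both directions, `f_i, f_j` take values in `[0,1]`, and
`∫ f_i dμ − e^{2ε}·∫ f_j dμ − (1 + e^ε)·δ ≥ 0`, then `∫ f_i dν ≥ ∫ f_j dν`. -/
theorem smoothed_ordering_preserved {Ω : Type*} [MeasurableSpace Ω]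
    (μ ν : Measure Ω) [IsProbabilityMeasure μ] [IsProbabilityMeasure ν]
    (ε δ : ℝ) (hε : 0 ≤ ε) (hδ : 0 ≤ δ)
    (hind₁ : ∀ S : Set Ω, MeasurableSet S →
      (μ S).toReal ≤ Real.exp ε * (ν S).toReal + δ)
    (hind₂ : ∀ S : Set Ω, MeasurableSet S →
      (ν S).toReal ≤ Real.exp ε * (μ S).toReal + δ)
    (fi fj : Ω → ℝ) (hfi : Measurable fi) (hfj : Measurable fj)
    (hfi0 : ∀ x, 0 ≤ fi x) (hfi1 : ∀ x, fi x ≤ 1)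
    (hfj0 : ∀ x, 0 ≤ fj x) (hfj1 : ∀ x, fj x ≤ 1)
    (hgap : (∫ x, fi x ∂μ) - Real.exp (2 * ε) * (∫ x, fj x ∂μ) -
        (1 + Real.exp ε) * δ ≥ 0) :
    (∫ x, fi x ∂ν) ≥ ∫ x, fj x ∂ν := by
  have hi := integral_le_mul_integral_add_of_measure_le hind₁ hfi hfi0 hfi1
  have hj := integral_le_mul_integral_add_of_measure_le hind₂ hfj hfj0 hfj1
  have hexp : Real.exp (2 * ε) = Real.exp ε * Real.exp ε := by rw [two_mul, Real.exp_add]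
  rw [hexp] at hgap
  refine hj.trans (le_of_mul_le_mul_left ?_ (Real.exp_pos ε))
  linarith
end

section
/- Fix σ > 0 and ε ≥ 0. The function g : (0, ∞) → ℝ defined by g(L) = Φ(L/(2σ) − εσ/L) − e^ε·Φ(−L/(2σ) − εσ/L) is strictly monotone increasing in L. -/
open MeasureTheory ProbabilityTheory Real

/-- The standard Gaussian cumulative distribution function is differentiable, with derivative the
standard Gaussian density. -/
theorem hasDerivAt_stdGaussianCDF (x : ℝ) :
    HasDerivAt stdGaussianCDF (gaussianPDFReal 0 1 x) x := by
  have hint : Integrable (gaussianPDFReal 0 1) := integrable_gaussianPDFReal 0 1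
  have hcont : Continuous (gaussianPDFReal 0 1) := by
    rw [gaussianPDFReal_def]
    fun_prop
  have hcdf (y : ℝ) : stdGaussianCDF y = ∫ t in Set.Iic y, gaussianPDFReal 0 1 t := by
    rw [stdGaussianCDF, gaussianReal_apply_eq_integral 0 one_ne_zero, ENNReal.toReal_ofReal]
    exact integral_nonneg fun t => gaussianPDFReal_nonneg 0 1 t
  have heq : stdGaussianCDF =
      fun y => stdGaussianCDF 0 + ∫ t in (0 : ℝ)..y, gaussianPDFReal 0 1 t := by
    funext y
    rw [hcdf y, hcdf 0,
      ← intervalIntegral.integral_Iic_sub_Iic hint.integrableOn hint.integrableOn]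
    ring
  rw [heq]
  exact (hcont.integral_hasStrictDerivAt 0 x).hasDerivAt.const_add _

/-- At the two arguments `u - v` and `-u - v` the standard Gaussian densities differ by the
factor `exp (2 * u * v)`. -/
theorem exp_mul_gaussianPDFReal_neg_sub (u v : ℝ) :
    Real.exp (2 * (u * v)) * gaussianPDFReal 0 1 (-u - v) = gaussianPDFReal 0 1 (u - v) := by
  simp only [gaussianPDFReal_def]
  rw [mul_left_comm, ← Real.exp_add]
  congr 2
  push_cast
  ring

/-- The privacy parameter `g` has derivative `φ(L/(2σ) − εσ/L) / σ`, where `φ` is the standard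
Gaussian density. -/
theorem hasDerivAt_delta_radius {σ L : ℝ} (ε : ℝ) (hσ : σ ≠ 0) (hL : L ≠ 0) :
    HasDerivAt
      (fun L : ℝ => stdGaussianCDF (L / (2 * σ) - ε * σ / L) -
        Real.exp ε * stdGaussianCDF (-(L / (2 * σ)) - ε * σ / L))
      (gaussianPDFReal 0 1 (L / (2 * σ) - ε * σ / L) / σ) L := by
  have hu : HasDerivAt (fun L : ℝ => L / (2 * σ)) (1 / (2 * σ)) L :=
    (hasDerivAt_id L).div_const _
  obtain ⟨d, hv⟩ : ∃ d, HasDerivAt (fun L : ℝ => ε * σ / L) d L :=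
    ⟨_, (hasDerivAt_const L (ε * σ)).fun_div (hasDerivAt_id L) hL⟩
  have hφ := exp_mul_gaussianPDFReal_neg_sub (L / (2 * σ)) (ε * σ / L)
  rw [show 2 * (L / (2 * σ) * (ε * σ / L)) = ε by field_simp] at hφ
  have h₁ := (hasDerivAt_stdGaussianCDF _).comp L (hu.fun_sub hv)
  have h₂ := ((hasDerivAt_stdGaussianCDF _).comp L (hu.fun_neg.fun_sub hv)).const_mul (Real.exp ε)
  refine (h₁.fun_sub h₂).congr_deriv ?_
  rw [← mul_assoc, hφ]
  field_simp
  ring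

/-- **Monotonicity in the radius.** For fixed `σ > 0` and `ε ≥ 0`, the tight privacy
parameter `g(L) = Φ(L/(2σ) − εσ/L) − e^ε·Φ(−L/(2σ) − εσ/L)` is strictly monotone
increasing on `(0, ∞)`. -/
theorem delta_strictMonoOn_radius (σ ε : ℝ) (hσ : 0 < σ) (hε : 0 ≤ ε) :
    StrictMonoOn
      (fun L : ℝ => stdGaussianCDF (L / (2 * σ) - ε * σ / L) -
        Real.exp ε * stdGaussianCDF (-(L / (2 * σ)) - ε * σ / L))
      (Set.Ioi (0 : ℝ)) := by
  have hderiv (L : ℝ) (hL : L ∈ Set.Ioi (0 : ℝ)) :=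
    hasDerivAt_delta_radius ε hσ.ne' (ne_of_gt hL)
  refine strictMonoOn_of_deriv_pos (convex_Ioi 0)
    (fun L hL => (hderiv L hL).continuousAt.continuousWithinAt) fun L hL => ?_
  rw [(hderiv L (interior_subset hL)).deriv]
  exact div_pos (gaussianPDFReal_pos 0 1 _ one_ne_zero) hσ
end

section
/- Fix σ > 0 and L > 0. Then Φ(L/(2σ) − εσ/L) − e^ε·Φ(−L/(2σ) − εσ/L) tends to 0 as ε → ∞, where Φ is the cumulative distribution function of the standard Gaussian; in particular, for every δ > 0 there exists ε ≥ 0 such that Φ(L/(2σ) − εσ/L) − e^ε·Φ(−L/(2σ) − εσ/L) ≤ δ. -/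
open MeasureTheory ProbabilityTheory Real Filter

/-- `stdGaussianCDF` agrees with `ProbabilityTheory.cdf`. -/
theorem stdGaussianCDF_eq_cdf : stdGaussianCDF = cdf (gaussianReal 0 1) := by
  ext x
  rw [cdf_eq_real]
  rfl

/-- The Chernoff bound for the lower tail of the standard Gaussian. -/
theorem stdGaussianCDF_le_exp {t : ℝ} (ht : 0 ≤ t) (x : ℝ) :
    stdGaussianCDF x ≤ Real.exp (t * x + t ^ 2 / 2) := by
  have h := measure_le_le_exp_mul_mgf (μ := gaussianReal 0 1) (X := id) x
    (neg_nonpos.mpr ht) (integrable_exp_mul_gaussianReal (-t))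
  rw [mgf_id_gaussianReal, ← Real.exp_add] at h
  simpa [stdGaussianCDF, Measure.real, Set.Iic] using h

/-- **Feasibility of the certification optimisation.** For fixed `σ > 0` and `L > 0`,
`Φ(L/(2σ) − εσ/L) − e^ε·Φ(−L/(2σ) − εσ/L) → 0` as `ε → ∞`; in particular for every
`δ > 0` there is `ε ≥ 0` making this quantity at most `δ`. -/
theorem delta_tendsto_zero (σ L : ℝ) (hσ : 0 < σ) (hL : 0 < L) :
    Tendsto
      (fun ε : ℝ => stdGaussianCDF (L / (2 * σ) - ε * σ / L) -
        Real.exp ε * stdGaussianCDF (-(L / (2 * σ)) - ε * σ / L))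
      atTop (nhds 0) ∧
    ∀ δ : ℝ, 0 < δ → ∃ ε : ℝ, 0 ≤ ε ∧
      stdGaussianCDF (L / (2 * σ) - ε * σ / L) -
        Real.exp ε * stdGaussianCDF (-(L / (2 * σ)) - ε * σ / L) ≤ δ := by
  have hfirst : Tendsto (fun ε : ℝ => stdGaussianCDF (L / (2 * σ) - ε * σ / L))
      atTop (nhds 0) := by
    rw [stdGaussianCDF_eq_cdf]
    refine (tendsto_cdf_atBot _).comp (tendsto_atBot_add_const_left _ _ ?_)
    exact tendsto_neg_atTop_atBot.comp
      ((tendsto_id.atTop_mul_const hσ).atTop_div_const hL)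
  have hbound (ε : ℝ) : Real.exp ε * stdGaussianCDF (-(L / (2 * σ)) - ε * σ / L) ≤
      Real.exp ((L / σ) ^ 2 + -ε) := by
    calc
      _ ≤ Real.exp ε * Real.exp (2 * L / σ * (-(L / (2 * σ)) - ε * σ / L) +
            (2 * L / σ) ^ 2 / 2) := by
        gcongr
        exact stdGaussianCDF_le_exp (by positivity) _
      _ = Real.exp ((L / σ) ^ 2 + -ε) := by
        rw [← Real.exp_add]
        congr 1
        field_simp
        ring
  have hsecond : Tendsto (fun ε : ℝ => Real.exp ε *
      stdGaussianCDF (-(L / (2 * σ)) - ε * σ / L)) atTop (nhds 0) :=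
    squeeze_zero (fun ε => mul_nonneg (Real.exp_pos ε).le ENNReal.toReal_nonneg) hbound
      (Real.tendsto_exp_atBot.comp
        (tendsto_atBot_add_const_left _ _ tendsto_neg_atTop_atBot))
  have hlim := hfirst.sub hsecond
  rw [sub_zero] at hlim
  refine ⟨hlim, fun δ hδ => ?_⟩
  exact ((eventually_ge_atTop 0).and (hlim.eventually_le_const hδ)).exists
end
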